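/- (Equivalence of the Kac–Wakimoto and Date–Jimbo–Kashiwara–Miwa forms of the twisted ŝl₂ (KdV) hierarchy.) Let τ ∈ ℂ[t₁,t₃,t₅,…] be a polynomial in the odd-indexed variables t̂ = (t₁,t₃,t₅,…). Then the following are equivalent. (i) As an identity in ℂ[t̂′,t̂″]: Res_z( z^{−1} e^{2ξ̂(t̂′−t̂″,z)} τ(t̂′ − 2[z⁻¹]_o) τ(t̂″ + 2[z⁻¹]_o) ) = 4 Σ_{j≥0} (2j+1)(t′_{2j+1} − t″_{2j+1})(∂_{t′_{2j+1}} − ∂_{t″_{2j+1}})(τ(t̂′)τ(t̂″)) + τ(t̂′)τ(t̂″). (ii) For every integer m ≥ 0, as an identity in ℂ[t̂′,t̂″]: Res_z( z^{2m} e^{ξ̂(t̂′−t̂″,z)} τ(t̂′ − [z⁻¹]_o) τ(t̂″ + [z⁻¹]_o) ) = 0. -/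

import Mathlib

noncomputable section

/-- The ring `ℂ[t̂′,t̂″]` in the odd-indexed variables: the variable `(false, j)` is
`t′_{2j+1}` and `(true, j)` is `t″_{2j+1}`. -/
abbrev A2 : Type := MvPolynomial (Bool × ℕ) ℂ

/-- The coefficients of `e^{ξ̂(t̂,z)} = exp(Σ_{j≥0} t_{2j+1} z^{2j+1}) = Σ_{n≥0} e_n zⁿ`,
with `a j` playing the role of `t_{2j+1}`.  Since `ξ̂` has no constant term, the
coefficient of `z^n` only involves `ξ̂^k` for `k ≤ n` and the variables `t_{2j+1}` with
`2j+1 ≤ n`, so it may be computed from the truncated exponential below. -/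
def schurOdd (a : ℕ → A2) (n : ℕ) : A2 :=
  ∑ k ∈ Finset.range (n + 1), ((k.factorial : ℂ))⁻¹ •
    (((∑ j ∈ Finset.range n, Polynomial.C (a j) * Polynomial.X ^ (2 * j + 1)) ^ k :
      Polynomial A2).coeff n)

/-- `τ(t̂^{(b)} + c[u]_o)` : substitute `t_{2j+1} ↦ t^{(b)}_{2j+1} + (c/(2j+1))u^{2j+1}` in
`τ ∈ ℂ[t₁,t₃,t₅,…]`, yielding a polynomial in `u` (where `u = z` or `u = z⁻¹`) with
coefficients in `ℂ[t̂′,t̂″]`.  The variable `j : ℕ` of `τ` stands for `t_{2j+1}`. -/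
def substShiftOdd (b : Bool) (c : ℂ) (τ : MvPolynomial ℕ ℂ) : Polynomial A2 :=
  MvPolynomial.aeval
    (fun j : ℕ => Polynomial.C (MvPolynomial.X (b, j)) +
      Polynomial.C (MvPolynomial.C (c / (2 * (j : ℂ) + 1))) * Polynomial.X ^ (2 * j + 1)) τ

/-- `Res_z ( z^k · E(z) · P(z⁻¹) )` where `E(z) = Σ_{n≥0} (e n) zⁿ` and
`P(z⁻¹) = Σ_j (P.coeff j) z^{−j}`: the coefficient of `z^{-1}`, i.e.
`Σ_j e_{j−k−1} · P_j` (terms with `j − k − 1 < 0` being absent). -/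
def resNeg (e : ℕ → A2) (k : ℤ) (P : Polynomial A2) : A2 :=
  ∑ j ∈ Finset.range (P.natDegree + 1),
    (if 0 ≤ (j : ℤ) - k - 1 then e ((j : ℤ) - k - 1).toNat else 0) * P.coeff j

/-- `Σ_{j≥0} (2j+1)(t′_{2j+1} − t″_{2j+1})(∂_{t′_{2j+1}} − ∂_{t″_{2j+1}}) F`,
a finite sum over the variables actually occurring in `F`. -/
def sumOpOdd (F : A2) : A2 :=
  ∑ v ∈ F.vars, ((2 * v.2 + 1 : ℕ) : ℂ) •
    ((MvPolynomial.X ((false, v.2) : Bool × ℕ) - MvPolynomial.X ((true, v.2) : Bool × ℕ)) *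
      (if v.1 then -(MvPolynomial.pderiv v F) else MvPolynomial.pderiv v F))

namespace KW
open Finset

theorem ode_unique {B : Type*} [CommRing B] [IsDomain B] [CharZero B] (η f g : PowerSeries B)
    (hf : PowerSeries.derivative B f = η * f) (hg : PowerSeries.derivative B g = η * g)
    (h0 : PowerSeries.coeff 0 f = PowerSeries.coeff 0 g) : f = g := by
  ext n
  induction n using Nat.strong_induction_on with
  | _ n ih =>
    cases n with
    | zero => exact h0
    | succ n =>
      have h1 := congrArg (PowerSeries.coeff n) hf
      have h2 := congrArg (PowerSeries.coeff n) hg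
      rw [PowerSeries.coeff_derivative, PowerSeries.coeff_mul] at h1 h2
      have hn : ((n : B) + 1) ≠ 0 := by exact_mod_cast Nat.succ_ne_zero n
      apply mul_right_cancel₀ hn
      rw [h1, h2]
      apply Finset.sum_congr rfl
      intro p hp
      rw [ih p.2 (by have := Finset.HasAntidiagonal.mem_antidiagonal.1 hp; omega)]

theorem dmul {B : Type*} [CommRing B] (f g : PowerSeries B) : PowerSeries.derivative B (f * g) =
    f * PowerSeries.derivative B g + g * PowerSeries.derivative B f := by
  rw [Derivation.leibniz]; rfl

theorem dadd {B : Type*} [CommRing B] (f g : PowerSeries B) : PowerSeries.derivative B (f + g) =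
    PowerSeries.derivative B f + PowerSeries.derivative B g := map_add _ _ _

theorem dsub {B : Type*} [CommRing B] (f g : PowerSeries B) : PowerSeries.derivative B (f - g) =
    PowerSeries.derivative B f - PowerSeries.derivative B g := map_sub _ _ _

/-- the series `ξ`. -/
def xi (a : ℕ → A2) : PowerSeries A2 := PowerSeries.mk fun n => if Odd n then a (n / 2) else 0

/-- the series `e^ξ`. -/
def ES (a : ℕ → A2) : PowerSeries A2 := PowerSeries.mk (schurOdd a)

theorem X_dvd_xi (a : ℕ → A2) : PowerSeries.X ∣ xi a := by
  rw [PowerSeries.X_dvd_iff]; simp [xi]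

theorem coeff_xi_pow_lt (a : ℕ → A2) (k n : ℕ) (h : n < k) :
    PowerSeries.coeff n (xi a ^ k) = 0 := by
  have := pow_dvd_pow_of_dvd (X_dvd_xi a) k
  exact (PowerSeries.X_pow_dvd_iff.1 this) n h

theorem coeff_trunc (a : ℕ → A2) (n k : ℕ) :
    (((∑ j ∈ Finset.range n, Polynomial.C (a j) * Polynomial.X ^ (2 * j + 1)) ^ k :
      Polynomial A2).coeff n) = PowerSeries.coeff n (xi a ^ k) := by
  rw [← Polynomial.coeff_coe, Polynomial.coe_pow, ← sub_eq_zero, ← map_sub]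
  refine PowerSeries.X_pow_dvd_iff.1 (dvd_trans ?_ (sub_dvd_pow_sub_pow _ _ k)) n (Nat.lt_succ_self n)
  rw [PowerSeries.X_pow_dvd_iff]
  intro m hm
  rw [map_sub, Polynomial.coeff_coe, sub_eq_zero, Polynomial.finsetSum_coeff]
  simp only [Polynomial.coeff_C_mul, Polynomial.coeff_X_pow, xi, PowerSeries.coeff_mk]
  split_ifs with ho
  · obtain ⟨j, rfl⟩ := ho
    rw [Finset.sum_eq_single j]
    · simp; congr 1; omega
    · intro b _ hb; rw [if_neg (by omega)]; simp
    · intro h; simp at h; omega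
  · apply Finset.sum_eq_zero
    intro j _
    rw [if_neg]; simp
    rintro rfl; exact ho ⟨j, rfl⟩

theorem schurOdd_eq (a : ℕ → A2) (n K : ℕ) (h : n < K) :
    schurOdd a n = ∑ k ∈ Finset.range K, ((k.factorial : ℂ))⁻¹ • PowerSeries.coeff n (xi a ^ k) := by
  rw [schurOdd]
  simp only [coeff_trunc]
  apply Finset.sum_subset
  · intro x hx; simp at *; omega
  · intro k _ hk
    rw [coeff_xi_pow_lt a k n (by simpa using hk), smul_zero]

theorem schurOdd_zero (a : ℕ → A2) : schurOdd a 0 = 1 := by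
  simp [schurOdd]

theorem ES_ode (a : ℕ → A2) :
    PowerSeries.derivative A2 (ES a) = PowerSeries.derivative A2 (xi a) * ES a := by
  ext1 n
  rw [PowerSeries.coeff_derivative, PowerSeries.coeff_mul, ES, PowerSeries.coeff_mk,
    schurOdd_eq a (n+1) (n+2) (by omega)]
  have : ∀ p ∈ Finset.HasAntidiagonal.antidiagonal n, PowerSeries.coeff p.1 (PowerSeries.derivative A2 (xi a)) *
      PowerSeries.coeff p.2 (PowerSeries.mk (schurOdd a)) =
      ∑ k ∈ Finset.range (n+1), ((k.factorial : ℂ))⁻¹ •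
        (PowerSeries.coeff p.1 (PowerSeries.derivative A2 (xi a)) * PowerSeries.coeff p.2 (xi a ^ k)) := by
    intro p hp
    rw [PowerSeries.coeff_mk, schurOdd_eq a p.2 (n+1)
      (by have := Finset.HasAntidiagonal.mem_antidiagonal.1 hp; omega), Finset.mul_sum]
    simp
  rw [Finset.sum_congr rfl this, Finset.sum_comm, Finset.sum_range_succ', add_mul, Finset.sum_mul]
  have h0 : ((Nat.factorial 0 : ℂ))⁻¹ • PowerSeries.coeff (n+1) (xi a ^ 0) * ((n : A2) + 1) = 0 := by
    simp [PowerSeries.coeff_one]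
  rw [h0, add_zero]
  apply Finset.sum_congr rfl
  intro k _
  rw [← Finset.smul_sum, ← PowerSeries.coeff_mul, smul_mul_assoc, ← PowerSeries.coeff_derivative,
    PowerSeries.derivative_pow]
  have h2 : ((k+1 : ℕ) : PowerSeries A2) * xi a ^ (k+1-1) * PowerSeries.derivative A2 (xi a)
     = ((k+1 : ℕ) : ℂ) • (PowerSeries.derivative A2 (xi a) * xi a ^ k) := by
    rw [Nat.cast_smul_eq_nsmul, nsmul_eq_mul]; simp; ring
  rw [h2, PowerSeries.coeff_smul, smul_smul]
  congr 1
  rw [Nat.factorial_succ]; push_cast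
  have : (k : ℂ) + 1 ≠ 0 := by exact_mod_cast Nat.succ_ne_zero k
  have : (k.factorial : ℂ) ≠ 0 := by exact_mod_cast Nat.factorial_ne_zero k
  field_simp

/-- `e^{-ξ}` -/
def EM (a : ℕ → A2) : PowerSeries A2 := PowerSeries.mk fun n => (-1)^n * schurOdd a n

theorem EM_ode (a : ℕ → A2) :
    PowerSeries.derivative A2 (EM a) = -PowerSeries.derivative A2 (xi a) * EM a := by
  ext1 n
  have h := congrArg (PowerSeries.coeff n) (ES_ode a)
  rw [PowerSeries.coeff_derivative, PowerSeries.coeff_mul, ES, PowerSeries.coeff_mk] at h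
  rw [PowerSeries.coeff_derivative, PowerSeries.coeff_mul, EM, PowerSeries.coeff_mk, mul_assoc, h,
    Finset.mul_sum]
  apply Finset.sum_congr rfl
  intro p hp
  rw [Finset.HasAntidiagonal.mem_antidiagonal] at hp
  rw [PowerSeries.coeff_mk, map_neg, PowerSeries.coeff_derivative, PowerSeries.coeff_mk, xi,
    PowerSeries.coeff_mk]
  split_ifs with ho
  · have he : Even p.1 := by
      rcases Nat.even_or_odd p.1 with h | h
      · exact h
      · exact absurd ho (Nat.not_odd_iff_even.2 h.add_one)
    rw [← hp, pow_succ, pow_add, he.neg_one_pow]; ring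
  · simp

theorem ES_mul_EM (a : ℕ → A2) : ES a * EM a = 1 := by
  apply ode_unique 0
  · rw [Derivation.leibniz, ES_ode, EM_ode]; simp only [smul_eq_mul]; ring
  · simp
  · simp [PowerSeries.coeff_mul, ES, EM, schurOdd_zero]

theorem ES_sq (a : ℕ → A2) : ES a * ES a = ES (fun j => 2 * a j) := by
  apply ode_unique (PowerSeries.derivative A2 (xi (fun j => 2 * a j)))
  · have : xi (fun j => 2 * a j) = xi a + xi a := by
      ext1 n; simp only [xi, PowerSeries.coeff_mk, map_add]; split_ifs <;> ring
    rw [Derivation.leibniz, ES_ode, this, map_add]; simp only [smul_eq_mul]; ring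
  · exact ES_ode _
  · simp [PowerSeries.coeff_mul, ES, schurOdd_zero]

theorem T0 (a : ℕ → A2) (N : ℕ) : ∑ q ∈ range (N+1), (-1)^q * schurOdd a (N - q) * schurOdd a q
    = if N = 0 then 1 else 0 := by
  have h := congrArg (PowerSeries.coeff N) (ES_mul_EM a)
  rw [mul_comm, PowerSeries.coeff_mul, PowerSeries.coeff_one,
    Finset.Nat.sum_antidiagonal_eq_sum_range_succ_mk] at h
  rw [← h]
  apply Finset.sum_congr rfl; intro q _; simp [ES, EM]; ring

theorem Tsq (a : ℕ → A2) (N : ℕ) : ∑ q ∈ range (N+1), schurOdd a (N - q) * schurOdd a q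
    = schurOdd (fun j => 2 * a j) N := by
  have h := congrArg (PowerSeries.coeff N) (ES_sq a)
  rw [mul_comm, PowerSeries.coeff_mul,
    Finset.Nat.sum_antidiagonal_eq_sum_range_succ_mk] at h
  simp only [ES, PowerSeries.coeff_mk] at h
  rw [← h]
  apply Finset.sum_congr rfl; intro q _; ring

theorem T1 (a : ℕ → A2) (N : ℕ) :
    ∑ q ∈ range (N+1), (-1)^q * (q : A2) * schurOdd a (N - q) * schurOdd a q
    = if Odd N then -((N : A2) * a (N / 2)) else 0 := by
  have h : PowerSeries.X * PowerSeries.derivative A2 (EM a) * ES a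
      = - (PowerSeries.X * PowerSeries.derivative A2 (xi a)) := by
    rw [EM_ode]
    linear_combination (-PowerSeries.X * PowerSeries.derivative A2 (xi a)) * ES_mul_EM a
  have hc : ∀ f : PowerSeries A2, ∀ n, PowerSeries.coeff n (PowerSeries.X * PowerSeries.derivative A2 f)
      = n * PowerSeries.coeff n f := by
    intro f n
    cases n with
    | zero => simp
    | succ n => rw [PowerSeries.coeff_succ_X_mul, PowerSeries.coeff_derivative]; push_cast; ring
  have h := congrArg (PowerSeries.coeff N) h
  rw [PowerSeries.coeff_mul, map_neg, hc,
    Finset.Nat.sum_antidiagonal_eq_sum_range_succ_mk] at h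
  simp only [hc, ES, EM, xi, PowerSeries.coeff_mk] at h
  rw [show (if Odd N then -((N : A2) * a (N / 2)) else 0) = -((N : A2) * if Odd N then a (N/2) else 0) by
    split_ifs <;> simp, ← h]
  apply Finset.sum_congr rfl; intro q _; ring

/-- coefficients of `(1-x)/(1+x)` -/
def r (s : ℕ) : ℂ := if s = 0 then 1 else 2 * (-1)^s

theorem r_rec (s : ℕ) : r (s+1) + r s = if s = 0 then -1 else 0 := by
  unfold r
  rcases s with _ | s
  · norm_num
  · simp; ring

/-- sign -/
def eps (b : Bool) : ℂ := if b then 1 else -1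

/-- the shift -/
def sg (c : ℂ) : A2 →ₐ[ℂ] Polynomial A2 :=
  MvPolynomial.aeval (fun v : Bool × ℕ => Polynomial.C (MvPolynomial.X v) +
      Polynomial.C (MvPolynomial.C (eps v.1 * c / (2 * (v.2 : ℂ) + 1))) * Polynomial.X ^ (2 * v.2 + 1))

/-- the differences -/
def dd (j : ℕ) : A2 := MvPolynomial.X ((false, j) : Bool × ℕ) - MvPolynomial.X ((true, j) : Bool × ℕ)

theorem sg_dd (j : ℕ) : sg 1 (dd j) = Polynomial.C (dd j) +
    Polynomial.C (MvPolynomial.C (-2 / (2 * (j : ℂ) + 1))) * Polynomial.X ^ (2 * j + 1) := by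
  simp only [sg, dd, map_sub, MvPolynomial.aeval_X, eps]
  have : (-2 / (2 * (j : ℂ) + 1)) = (-1) / (2 * (j : ℂ) + 1) - 1 / (2 * (j : ℂ) + 1) := by ring
  rw [this]
  simp only [map_sub, if_true]
  simp
  ring

/-- the series `R(Xz)` -/
def RS : PowerSeries (Polynomial A2) :=
  PowerSeries.mk fun s => Polynomial.C (MvPolynomial.C (r s)) * Polynomial.X ^ s

/-- the series `G` -/
def GS : PowerSeries (Polynomial A2) :=
  PowerSeries.mk fun s => if Even s then Polynomial.X ^ (s+1) else 0

/-- Xz -/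
def yy : PowerSeries (Polynomial A2) := PowerSeries.X * PowerSeries.C Polynomial.X

theorem coeff_mul_yy (f : PowerSeries (Polynomial A2)) (n : ℕ) :
    PowerSeries.coeff (n+1) (yy * f) = Polynomial.X * PowerSeries.coeff n f := by
  rw [yy, mul_assoc, PowerSeries.coeff_succ_X_mul, PowerSeries.coeff_C_mul]

theorem coeff_zero_mul_yy (f : PowerSeries (Polynomial A2)) :
    PowerSeries.coeff 0 (yy * f) = 0 := by
  rw [yy, mul_assoc, PowerSeries.coeff_zero_X_mul]

theorem RS_eq : RS + yy * RS = 1 - yy := by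
  have hy : yy = yy * 1 := by simp
  conv_rhs => rw [hy]
  ext1 n
  rw [map_add, map_sub]
  rcases n with _ | n
  · rw [coeff_zero_mul_yy, coeff_zero_mul_yy]; simp [RS, r]
  · rw [coeff_mul_yy, coeff_mul_yy, PowerSeries.coeff_one, PowerSeries.coeff_one]
    simp only [RS, PowerSeries.coeff_mk]
    have h := r_rec n
    have : r (n+1) = (if n = 0 then -1 else 0) - r n := by rw [← h]; ring
    rw [this]
    rcases n with _ | n
    · simp; ring
    · simp; ring

theorem GS_eq : GS = yy * (yy * GS) + PowerSeries.C Polynomial.X := by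
  ext1 n
  rw [map_add]
  rcases n with _ | _ | n
  · rw [coeff_zero_mul_yy]; simp [GS]
  · rw [coeff_mul_yy, coeff_zero_mul_yy]; simp [GS, PowerSeries.coeff_C]
  · rw [coeff_mul_yy, coeff_mul_yy]; simp only [GS, PowerSeries.coeff_mk, PowerSeries.coeff_C]
    have : Even (n+1+1) ↔ Even n := by rw [Nat.even_add_one, Nat.not_even_iff_odd, Nat.odd_add_one, Nat.not_odd_iff_even]
    simp only [this]
    split_ifs <;> simp_all
    ring

theorem RS_ode : PowerSeries.derivative (Polynomial A2) RS = (-2 * GS) * RS := by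
  have h1 := congrArg (PowerSeries.derivative (Polynomial A2)) RS_eq
  have hy : PowerSeries.derivative (Polynomial A2) yy = PowerSeries.C Polynomial.X := by
    rw [yy, dmul, PowerSeries.derivative_X, PowerSeries.derivative_C]; simp
  simp only [dadd, dsub, dmul, hy, PowerSeries.derivative_one] at h1
  have hz : PowerSeries.constantCoeff yy = 0 := by simp [yy]
  have n1 : (1 + yy) ≠ 0 := by
    intro h; have := congrArg PowerSeries.constantCoeff h; simp [hz] at this
  have n2 : (1 - yy) ≠ 0 := by
    intro h; have := congrArg PowerSeries.constantCoeff h; simp [hz] at this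
  apply mul_left_cancel₀ (mul_ne_zero (mul_ne_zero n1 n1) n2)
  have h3 := GS_eq
  have h2 := RS_eq
  set c : PowerSeries (Polynomial A2) := PowerSeries.C Polynomial.X
  linear_combination (1+yy)*(1-yy)*h1 + (-(1-yy)*c) * h2 + 2 * (1 + yy) * RS * h3 + 2 * c * h2

theorem deriv_map {B C : Type*} [CommRing B] [CommRing C] (f : B →+* C) (p : PowerSeries B) :
    PowerSeries.derivative C (PowerSeries.map f p) = PowerSeries.map f (PowerSeries.derivative B p) := by
  ext1 n; simp [PowerSeries.coeff_derivative]

theorem sg_ES : PowerSeries.map (sg 1).toRingHom (ES dd) =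
    RS * PowerSeries.map Polynomial.C (ES dd) := by
  apply ode_unique (PowerSeries.derivative _ (PowerSeries.map (sg 1).toRingHom (xi dd)))
  · rw [deriv_map, ES_ode, map_mul, deriv_map]
  · have : PowerSeries.derivative _ (PowerSeries.map (sg 1).toRingHom (xi dd))
      = PowerSeries.map Polynomial.C (PowerSeries.derivative A2 (xi dd)) - 2 * GS := by
      rw [deriv_map]
      ext1 n
      rw [map_sub, two_mul, map_add]
      simp only [PowerSeries.coeff_map, PowerSeries.coeff_derivative, xi, GS, PowerSeries.coeff_mk]
      have hE : Odd (n+1) ↔ Even n := by rw [Nat.odd_add_one, Nat.not_odd_iff_even]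
      simp only [hE]
      split_ifs with h
      · obtain ⟨k, rfl⟩ := h
        have hk : (k+k+1)/2 = k := by omega
        rw [hk]
        have e1 : (sg 1).toRingHom (dd k * (((k+k : ℕ) : A2) + 1)) = sg 1 (dd k) * (((k+k:ℕ) : Polynomial A2) + 1) := by
          simp
        rw [e1, sg_dd]
        have e2 : (Polynomial.C (MvPolynomial.C (-2 / (2 * (k : ℂ) + 1))) : Polynomial A2) * (((k+k : ℕ) : Polynomial A2) + 1) = -2 := by
          have : (((k+k : ℕ) : Polynomial A2) + 1) = Polynomial.C (MvPolynomial.C (2 * (k : ℂ) + 1)) := by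
            have h2 : (2 : ℂ) * (k : ℂ) + 1 = ((k + k + 1 : ℕ) : ℂ) := by push_cast; ring
            rw [h2, map_natCast, map_natCast]; push_cast; rfl
          rw [this, ← map_mul, ← map_mul]
          have : (2 * (k : ℂ) + 1) ≠ 0 := by exact_mod_cast Nat.succ_ne_zero (2*k)
          rw [div_mul_cancel₀ _ this, map_neg, map_neg, map_ofNat, map_ofNat]
        simp only [map_mul, map_add, map_natCast, map_one]
        have e3 : k + k + 1 = 2 * k + 1 := by ring
        rw [e3]
        linear_combination (Polynomial.X : Polynomial A2) ^ (2*k+1) * e2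
      · simp
    rw [this, dmul, RS_ode, deriv_map, ES_ode, map_mul]
    ring
  · simp [PowerSeries.coeff_mul, ES, RS, r, schurOdd_zero]

theorem sg_schur (q : ℕ) : sg 1 (schurOdd dd q) = ∑ s ∈ range (q+1),
    Polynomial.C (MvPolynomial.C (r s) * schurOdd dd (q - s)) * Polynomial.X ^ s := by
  have h := congrArg (PowerSeries.coeff q) sg_ES
  rw [PowerSeries.coeff_mul, Finset.Nat.sum_antidiagonal_eq_sum_range_succ_mk] at h
  simp only [RS, ES, PowerSeries.coeff_mk, PowerSeries.coeff_map] at h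
  refine h.trans (Finset.sum_congr rfl ?_)
  intro s _; rw [map_mul]; ring

/-- integer-indexed coefficients -/
def e (n : ℤ) : A2 := if 0 ≤ n then schurOdd dd n.toNat else 0

theorem e_nat (n : ℕ) : e n = schurOdd dd n := by simp [e]
theorem e_neg {n : ℤ} (h : n < 0) : e n = 0 := by rw [e, if_neg (by omega)]

/-- pairing -/
def L (g : ℕ → A2) : Polynomial A2 →ₗ[A2] A2 :=
  Polynomial.lsum fun j => LinearMap.toSpanSingleton A2 A2 (g j)

theorem L_monomial (g : ℕ → A2) (j : ℕ) (a : A2) : L g (Polynomial.monomial j a) = a * g j := by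
  simp [L, Polynomial.lsum_apply, Polynomial.sum_monomial_index]

/-- double pairing -/
def LL (g : ℕ → ℕ → A2) : Polynomial (Polynomial A2) →ₗ[A2] A2 :=
  Polynomial.lsum fun j => L (fun i => g i j)

theorem LL_monomial' (g : ℕ → ℕ → A2) (j : ℕ) (p : Polynomial A2) :
    LL g (Polynomial.monomial j p) = L (fun i => g i j) p := by
  simp [LL, Polynomial.lsum_apply, Polynomial.sum_monomial_index]

theorem LL_monomial (g : ℕ → ℕ → A2) (i j : ℕ) (a : A2) :
    LL g (Polynomial.monomial j (Polynomial.monomial i a)) = a * g i j := by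
  rw [LL_monomial', L_monomial]

theorem bi_induction {p : Polynomial (Polynomial A2) → Prop} (P : Polynomial (Polynomial A2))
    (h1 : ∀ P Q, p P → p Q → p (P + Q))
    (h2 : ∀ i j a, p (Polynomial.monomial j (Polynomial.monomial i a))) : p P := by
  induction P using Polynomial.induction_on' with
  | add P Q hP hQ => exact h1 _ _ hP hQ
  | monomial j q =>
    induction q using Polynomial.induction_on' with
    | add P Q hP hQ => rw [map_add]; exact h1 _ _ hP hQ
    | monomial i a => exact h2 _ _ _

theorem LL_add (g h : ℕ → ℕ → A2) (P) : LL (fun i j => g i j + h i j) P = LL g P + LL h P := by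
  induction P using bi_induction with
  | h1 P Q hP hQ => simp only [map_add, hP, hQ]; ring
  | h2 i j a => simp only [LL_monomial]; ring

theorem LL_smul (c : A2) (h : ℕ → ℕ → A2) (P) : LL (fun i j => c * h i j) P = c * LL h P := by
  induction P using bi_induction with
  | h1 P Q hP hQ => simp only [map_add, hP, hQ]; ring
  | h2 i j a => simp only [LL_monomial]; ring

theorem LL_sum {ι : Type*} (s : Finset ι) (g : ι → ℕ → ℕ → A2) (P) :
    LL (fun i j => ∑ k ∈ s, g k i j) P = ∑ k ∈ s, LL (g k) P := by
  induction P using bi_induction with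
  | h1 P Q hP hQ => simp only [map_add, hP, hQ, Finset.sum_add_distrib]
  | h2 i j a => simp only [LL_monomial, Finset.mul_sum]

theorem LL_swap (g : ℕ → ℕ → A2) (P) :
    LL g (Polynomial.Bivariate.swap P) = LL (fun i j => g j i) P := by
  induction P using bi_induction with
  | h1 P Q hP hQ => simp only [map_add, hP, hQ]
  | h2 i j a => rw [Polynomial.Bivariate.swap_monomial_monomial]; simp only [LL_monomial]

theorem LL_congr (g h : ℕ → ℕ → A2) (P : Polynomial (Polynomial A2)) 
    (H : ∀ i j, j ≤ P.natDegree → g i j = h i j) : LL g P = LL h P := by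
  simp only [LL, Polynomial.lsum_apply, Polynomial.sum_def]
  apply Finset.sum_congr rfl
  intro j hj
  have hj' := Polynomial.le_natDegree_of_mem_supp j hj
  congr 2
  ext i : 1
  exact H i j hj'

theorem LL_eval_X (h : ℕ → A2) (P : Polynomial (Polynomial A2)) :
    LL (fun i j => h (i + j)) P = L h (P.eval Polynomial.X) := by
  induction P using bi_induction with
  | h1 P Q hP hQ => simp only [map_add, hP, hQ, Polynomial.eval_add]
  | h2 i j a => 
    rw [LL_monomial, Polynomial.eval_monomial, Polynomial.X_pow_eq_monomial,
      Polynomial.monomial_mul_monomial, L_monomial, mul_one]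

theorem gneg {B : Type*} [CommRing B] (j : ℕ) : (-Polynomial.X : Polynomial B) ^ j = Polynomial.monomial j ((-1)^j) := by
  rw [neg_pow, Polynomial.X_pow_eq_monomial, ← Polynomial.C_1, ← Polynomial.C_neg, ← Polynomial.C_pow,
    Polynomial.C_mul_monomial, mul_one]
theorem neg_X_pow (j : ℕ) : (-Polynomial.X : Polynomial A2) ^ j = Polynomial.monomial j ((-1)^j) := 
  gneg j
theorem neg_X_odd (j : ℕ) : (-Polynomial.X : Polynomial A2) ^ (2 * j + 1) = -Polynomial.X ^ (2 * j + 1) := by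
  rw [gneg, Odd.neg_one_pow ⟨j, rfl⟩, Polynomial.X_pow_eq_monomial, Polynomial.monomial_neg]
theorem neg_X_even (j : ℕ) : (-Polynomial.X : Polynomial A2) ^ (2 * j) = Polynomial.X ^ (2 * j) := by
  rw [gneg, Even.neg_one_pow ⟨j, by ring⟩, Polynomial.X_pow_eq_monomial]

theorem LL_eval_neg (h : ℕ → A2) (P : Polynomial (Polynomial A2)) :
    LL (fun i j => (-1)^j * h (i + j)) P = L h (P.eval (-Polynomial.X)) := by
  induction P using bi_induction with
  | h1 P Q hP hQ => simp only [map_add, hP, hQ, Polynomial.eval_add]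
  | h2 i j a => 
    rw [LL_monomial, Polynomial.eval_monomial, neg_X_pow,
      Polynomial.monomial_mul_monomial, L_monomial, mul_assoc]

theorem LL_eval_der (h : ℕ → A2) (P : Polynomial (Polynomial A2)) :
    LL (fun i j => (-1)^j * (j * h (i + j))) P =
      - L h (Polynomial.X * (Polynomial.derivative P).eval (-Polynomial.X)) := by
  induction P using bi_induction with
  | h1 P Q hP hQ => simp only [map_add, hP, hQ, Polynomial.eval_add, mul_add, neg_add]
  | h2 i j a => 
    rw [LL_monomial, Polynomial.derivative_monomial, Polynomial.eval_monomial, neg_X_pow]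
    rcases j with _ | j
    · simp
    · have : (Polynomial.X : Polynomial A2) * ((Polynomial.monomial i) a * ((j + 1 : ℕ) : Polynomial A2) * (Polynomial.monomial (j + 1 - 1)) ((-1) ^ (j + 1 - 1)))
        = ((j + 1 : ℕ) : A2) • Polynomial.monomial (i + (j + 1)) (a * (-1)^j) := by
        rw [← Polynomial.monomial_one_one_eq_X, mul_right_comm, Polynomial.monomial_mul_monomial, ← mul_assoc, Polynomial.monomial_mul_monomial,
          mul_comm, ← nsmul_eq_mul, Nat.cast_smul_eq_nsmul]
        congr 2
        · congr 1
          simp; omega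
        · simp
      rw [this, map_smul, L_monomial]
      simp only [smul_eq_mul]; ring

/-- the vertex operator modes -/
def V (k : ℤ) : A2 →ₗ[ℂ] A2 :=
  ((L fun j => e (j - k)).restrictScalars ℂ).comp (sg 1).toLinearMap

theorem V_apply (k : ℤ) (F : A2) : V k F = L (fun j => e (j - k)) (sg 1 F) := rfl

/-- M -/
def M (p q : ℤ) : A2 := ∑ s ∈ range (q + 1).toNat, MvPolynomial.C (r s) * (e (p + s) * e (q - s))

theorem M_eq (p q : ℤ) (D : ℕ) (h : q < D) :
    M p q = ∑ s ∈ range D, MvPolynomial.C (r s) * (e (p + s) * e (q - s)) := by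
  apply Finset.sum_subset
  · intro x hx; simp at *; omega
  · intro x _ hx; rw [e_neg (n := q - x) (by simp at hx; omega)]; simp

theorem sg_e (q : ℤ) : sg 1 (e q) = ∑ s ∈ range (q + 1).toNat,
    Polynomial.monomial s (MvPolynomial.C (r s) * e (q - s)) := by
  rcases lt_or_ge q 0 with h | h
  · have : (q + 1).toNat = 0 := by omega
    rw [this, e_neg h]; simp
  · obtain ⟨n, rfl⟩ := Int.eq_ofNat_of_zero_le h
    have : ((n : ℤ) + 1).toNat = n + 1 := by omega
    rw [this, e_nat, sg_schur]
    apply Finset.sum_congr rfl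
    intro s hs
    have : ((n : ℤ) - s) = ((n - s : ℕ) : ℤ) := by simp at hs; omega
    rw [this, e_nat, Polynomial.C_mul_X_pow_eq_monomial]

theorem VV_aux (a b : ℤ) (p : Polynomial A2) :
    V a (L (fun j => e (j - b)) p) = LL (fun i j => M (i - a) (j - b)) (p.map (sg 1).toRingHom) := by
  induction p using Polynomial.induction_on' with
  | add P Q hP hQ => simp only [map_add, hP, hQ, Polynomial.map_add]
  | monomial j x =>
    rw [L_monomial, Polynomial.map_monomial, LL_monomial', V_apply, map_mul, sg_e]
    change _ = L _ (sg 1 x)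
    generalize sg 1 x = p
    induction p using Polynomial.induction_on' with
    | add P Q hP hQ => simp only [map_add, hP, hQ, add_mul]
    | monomial i y =>
      rw [L_monomial, Finset.mul_sum, map_sum, M, Finset.mul_sum]
      apply Finset.sum_congr rfl
      intro s _
      rw [Polynomial.monomial_mul_monomial, L_monomial]
      have : (((i + s : ℕ) : ℤ) - a) = i - a + s := by push_cast; ring
      rw [this]; ring

/-- two-variable shift -/
def PP (F : A2) : Polynomial (Polynomial A2) := (sg 1 F).map (sg 1).toRingHom

theorem VV (a b : ℤ) (F : A2) : V a (V b F) = LL (fun i j => M (i - a) (j - b)) (PP F) :=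
  VV_aux a b _

theorem PP_mul (F G : A2) : PP (F * G) = PP F * PP G := by simp [PP]
theorem PP_add (F G : A2) : PP (F + G) = PP F + PP G := by simp [PP]

theorem sg_X (c : ℂ) (v : Bool × ℕ) : sg c (MvPolynomial.X v) = Polynomial.C (MvPolynomial.X v) +
      Polynomial.C (MvPolynomial.C (eps v.1 * c / (2 * (v.2 : ℂ) + 1))) * Polynomial.X ^ (2 * v.2 + 1) := by
  simp [sg]

theorem sg_C (c a : ℂ) : sg c (MvPolynomial.C a) = Polynomial.C (MvPolynomial.C a) := by
  rw [← MvPolynomial.algebraMap_eq, AlgHom.commutes]; rfl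

theorem PP_C (a : ℂ) : PP (MvPolynomial.C a) = Polynomial.C (Polynomial.C (MvPolynomial.C a)) := by
  rw [PP, sg_C, Polynomial.map_C]
  change Polynomial.C (sg 1 _) = _
  rw [sg_C]

theorem PP_X (v : Bool × ℕ) : PP (MvPolynomial.X v) = Polynomial.C (Polynomial.C (MvPolynomial.X v) +
      Polynomial.C (MvPolynomial.C (eps v.1 * 1 / (2 * (v.2 : ℂ) + 1))) * Polynomial.X ^ (2 * v.2 + 1)) +
      Polynomial.C (Polynomial.C (MvPolynomial.C (eps v.1 * 1 / (2 * (v.2 : ℂ) + 1)))) * Polynomial.X ^ (2 * v.2 + 1) := by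
  rw [PP, sg_X, Polynomial.map_add, Polynomial.map_mul, Polynomial.map_C, Polynomial.map_C,
    Polynomial.map_pow, Polynomial.map_X]
  change Polynomial.C (sg 1 _) + Polynomial.C (sg 1 _) * _ = _
  rw [sg_C, sg_X]

theorem PP_swap (F : A2) : Polynomial.Bivariate.swap (PP F) = PP F := by
  induction F using MvPolynomial.induction_on with
  | C a => rw [PP_C, Polynomial.Bivariate.swap_C_C]
  | add p q hp hq => rw [PP_add, map_add, hp, hq]
  | mul_X p v hp =>
    rw [PP_mul, map_mul, hp, PP_X]
    congr 1
    simp only [map_add, map_mul, map_pow, Polynomial.Bivariate.swap_C_C, Polynomial.Bivariate.swap_X,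
      Polynomial.Bivariate.swap_Y]
    ring

theorem PP_eval_X (F : A2) : (PP F).eval Polynomial.X = sg 2 F := by
  induction F using MvPolynomial.induction_on with
  | C a => rw [PP_C, sg_C, Polynomial.eval_C]
  | add p q hp hq => rw [PP_add, map_add, Polynomial.eval_add, hp, hq]
  | mul_X p v hp =>
    rw [PP_mul, map_mul, Polynomial.eval_mul, hp, PP_X, sg_X]
    congr 1
    simp only [Polynomial.eval_add, Polynomial.eval_mul, Polynomial.eval_C, Polynomial.eval_pow, Polynomial.eval_X]
    have : eps v.1 * 2 / (2 * (v.2 : ℂ) + 1) = eps v.1 * 1 / (2 * (v.2 : ℂ) + 1) + eps v.1 * 1 / (2 * (v.2 : ℂ) + 1) := by ring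
    rw [this]
    simp only [map_add]
    ring

theorem PP_eval_neg (F : A2) : (PP F).eval (-Polynomial.X) = Polynomial.C F := by
  induction F using MvPolynomial.induction_on with
  | C a => rw [PP_C, Polynomial.eval_C]
  | add p q hp hq => rw [PP_add, map_add, Polynomial.eval_add, hp, hq]
  | mul_X p v hp =>
    rw [PP_mul, map_mul, Polynomial.eval_mul, hp, PP_X]
    congr 1
    simp only [Polynomial.eval_add, Polynomial.eval_mul, Polynomial.eval_C, Polynomial.eval_pow, Polynomial.eval_X]
    rw [neg_X_odd]
    ring

/-- difference derivative -/
def dm (j : ℕ) (F : A2) : A2 := MvPolynomial.pderiv ((false, j) : Bool × ℕ) F - MvPolynomial.pderiv ((true, j) : Bool × ℕ) F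

theorem PP_der (F : A2) (k : ℕ) : ((Polynomial.derivative (PP F)).eval (-Polynomial.X)).coeff k =
    if Even k then - dm (k / 2) F else 0 := by
  induction F using MvPolynomial.induction_on with
  | C a => simp [PP_C, dm]
  | add p q hp hq =>
    rw [PP_add, map_add, Polynomial.eval_add, Polynomial.coeff_add, hp, hq]
    split_ifs
    · simp only [dm, map_add]; ring
    · simp
  | mul_X p v hp =>
    rw [PP_mul, Polynomial.derivative_mul, Polynomial.eval_add, Polynomial.eval_mul, Polynomial.eval_mul,
      PP_eval_neg, PP_eval_neg, Polynomial.coeff_add, Polynomial.coeff_mul_C, Polynomial.coeff_C_mul, hp, PP_X]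
    have h : (Polynomial.eval (-Polynomial.X) (Polynomial.derivative (Polynomial.C (Polynomial.C (MvPolynomial.X v) +
      Polynomial.C (MvPolynomial.C (eps v.1 * 1 / (2 * (v.2 : ℂ) + 1))) * Polynomial.X ^ (2 * v.2 + 1)) +
      Polynomial.C (Polynomial.C (MvPolynomial.C (eps v.1 * 1 / (2 * (v.2 : ℂ) + 1)))) * Polynomial.X ^ (2 * v.2 + 1))) : Polynomial A2)
      = Polynomial.C (MvPolynomial.C (eps v.1)) * Polynomial.X ^ (2 * v.2) := by
      have hh : (eps v.1 : ℂ) = eps v.1 * 1 / (2 * (v.2 : ℂ) + 1) * ((2 * v.2 + 1 : ℕ) : ℂ) := by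
        have : (2 * (v.2 : ℂ) + 1) ≠ 0 := by exact_mod_cast Nat.succ_ne_zero (2*v.2)
        push_cast; field_simp
      rw [map_add, Polynomial.derivative_C, zero_add, Polynomial.derivative_C_mul_X_pow]
      conv_rhs => rw [hh]
      generalize eps v.1 * 1 / (2 * (v.2 : ℂ) + 1) = c
      simp only [Polynomial.eval_mul, Polynomial.eval_C, Polynomial.eval_pow, Polynomial.eval_X,
        Nat.add_sub_cancel]
      rw [neg_X_even]
      simp only [map_mul, map_natCast]
    rw [h, Polynomial.coeff_C_mul, Polynomial.coeff_X_pow]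
    obtain ⟨b, i⟩ := v
    have hd : ∀ j, dm j (p * MvPolynomial.X (b, i)) = dm j p * MvPolynomial.X (b, i) -
        p * (if j = i then MvPolynomial.C (eps b) else 0) := by
      intro j
      simp only [dm, Derivation.leibniz, MvPolynomial.pderiv_X, smul_eq_mul, Pi.single_apply, eps]
      by_cases hji : j = i
      · subst hji; cases b <;> simp <;> ring
      · have hij : ¬ i = j := fun h => hji h.symm
        simp [hji, hij]; ring
    simp only [hd]
    by_cases hk : Even k
    · obtain ⟨m, rfl⟩ := hk
      have h1 : (m + m) / 2 = m := by omega
      have h2 : (m + m = 2 * i) ↔ m = i := by omega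
      simp only [h1, h2]
      have h3 : Even (m + m) := ⟨m, rfl⟩
      simp only [h3, if_true]
      split_ifs <;> ring
    · have h2 : ¬ (k = 2 * i) := by rintro rfl; exact hk ⟨i, by ring⟩
      simp [hk, h2]

/-- sign of an integer exponent -/
def sn (n : ℤ) : A2 := if Even n then 1 else -1

theorem sn_add (m n : ℤ) : sn (m + n) = sn m * sn n := by
  simp only [sn, Int.even_add]; split_ifs <;> simp_all
theorem sn_sub (m n : ℤ) : sn (m - n) = sn m * sn n := by
  simp only [sn, Int.even_sub]; split_ifs <;> simp_all
theorem sn_sq (m : ℤ) : sn m * sn m = 1 := by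
  simp only [sn]; split_ifs <;> simp_all
theorem sn_nat (n : ℕ) : sn n = (-1)^n := by
  simp only [sn, Int.even_coe_nat]; split_ifs with h
  · rw [h.neg_one_pow]
  · rw [(Nat.not_even_iff_odd.1 h).neg_one_pow]

theorem r_sum (D : ℕ) (hD : 0 < D) (f : ℕ → A2) :
    ∑ s ∈ range D, MvPolynomial.C (r s) * f s = 2 * (∑ s ∈ range D, (-1)^s * f s) - f 0 := by
  obtain ⟨D, rfl⟩ : ∃ n, D = n + 1 := ⟨D - 1, by omega⟩
  rw [Finset.sum_range_succ', Finset.sum_range_succ', mul_add, Finset.mul_sum]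
  simp only [r]
  simp
  have : ∀ s : ℕ, (MvPolynomial.C (2 : ℂ) : A2) * (-1)^(s+1) * f (s+1) = 2 * ((-1)^(s+1) * f (s+1)) := by
    intro s; rw [map_ofNat]; ring
  simp only [this]; ring

theorem two_sided (f : ℤ → A2) (q : ℤ) (D : ℕ) :
    ∑ s ∈ range (D+1), f (q - s) + ∑ s ∈ range (D+1), f (q + s) - f q = ∑ b ∈ Finset.Icc (q - D) (q + D), f b := by
  induction D with
  | zero => simp
  | succ D ih =>
    rw [Finset.sum_range_succ, Finset.sum_range_succ _ (D+1)]
    have : Finset.Icc (q - (D+1 : ℕ)) (q + (D+1 : ℕ)) = insert (q - (D+1 : ℕ)) (insert (q + (D+1 : ℕ)) (Finset.Icc (q - D) (q + D))) := by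
      ext x; simp only [Finset.mem_Icc, Finset.mem_insert]; push_cast; omega
    rw [this, Finset.sum_insert, Finset.sum_insert, ← ih]
    · ring
    · simp
    · simp; omega

theorem full_sum (N lo hi : ℤ) (h1 : lo ≤ 0) (h2 : N ≤ hi) :
    ∑ b ∈ Finset.Icc lo hi, sn b * (e (N - b) * e b) = if N = 0 then 1 else 0 := by
  rcases lt_or_ge N 0 with h | h
  · rw [if_neg (by omega)]
    apply Finset.sum_eq_zero
    intro b _
    rcases lt_or_ge b 0 with hb | hb
    · rw [e_neg hb]; simp
    · rw [e_neg (n := N - b) (by omega)]; simp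
  · obtain ⟨n, rfl⟩ := Int.eq_ofNat_of_zero_le h
    have hs : (range (n+1)).map Nat.castEmbedding ⊆ Finset.Icc lo hi := by
      intro x hx; simp at hx; obtain ⟨a, ha, rfl⟩ := hx; simp; omega
    rw [← Finset.sum_subset hs, Finset.sum_map]
    · have := T0 dd n
      simp only [Nat.cast_eq_zero]
      rw [← this]
      apply Finset.sum_congr rfl
      intro q hq
      have : ((n : ℤ) - q) = ((n - q : ℕ) : ℤ) := by simp at hq; omega
      simp only [Nat.castEmbedding_apply]
      rw [this, e_nat, e_nat, sn_nat]; ring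
    · intro b _ hb
      rcases lt_or_ge b 0 with hb' | hb'
      · rw [e_neg hb']; simp
      · rw [e_neg (n := n - b)]; · simp
        by_contra hc
        apply hb
        simp only [Finset.mem_map, Finset.mem_range, Nat.castEmbedding_apply]
        exact ⟨b.toNat, by omega, by omega⟩

theorem M_symm (p q : ℤ) : M p q + M q p = if p + q = 0 then 2 * sn q else 0 := by
  set D : ℕ := p.natAbs + q.natAbs + 1 with hD
  set f : ℤ → A2 := fun b => sn b * (e (p + q - b) * e b) with hf
  rw [M_eq p q (D+1) (by omega), M_eq q p (D+1) (by omega), r_sum _ (by omega), r_sum _ (by omega)]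
  have h1 : ∀ s : ℕ, (-1)^s * (e (p + s) * e (q - s)) = sn q * f (q - s) := by
    intro s
    simp only [hf]
    rw [show p + q - (q - s) = p + s by ring, sn_sub, ← sn_nat, ← mul_assoc (sn q), ← mul_assoc (sn q), sn_sq, one_mul]
  have h2 : ∀ s : ℕ, (-1)^s * (e (q + s) * e (p - s)) = sn q * f (q + s) := by
    intro s
    simp only [hf]
    rw [show p + q - (q + s) = p - s by ring, sn_add, ← sn_nat, ← mul_assoc (sn q), ← mul_assoc (sn q), sn_sq, one_mul]
    ring
  have h3 : e p * e q = sn q * f q := by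
    simp only [hf]
    rw [show p + q - q = p by ring, ← mul_assoc, sn_sq, one_mul]
  simp only [h1, h2, ← Finset.mul_sum]
  have h5 := two_sided f q D
  have h4 := full_sum (p + q) (q - D) (q + D) (by omega) (by omega)
  rw [h4] at h5
  simp only [Nat.cast_zero, add_zero, sub_zero]
  have : (if p + q = 0 then 2 * sn q else 0 : A2) = 2 * sn q * (if p + q = 0 then 1 else 0) := by
    split_ifs <;> ring
  rw [this, ← h5]
  linear_combination -2 * h3

theorem V_anti (a b : ℤ) (F : A2) : V a (V b F) + V b (V a F) = if a + b = 0 then 2 * sn b * F else 0 := by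
  rw [VV, VV]
  conv_lhs => enter [2]; rw [← PP_swap, LL_swap]
  rw [← LL_add]
  have h : (fun i j : ℕ => M (i - a) (j - b) + M (j - b) (i - a)) =
      fun i j : ℕ => 2 * sn b * ((-1)^j * (fun n : ℕ => if (n : ℤ) = a + b then (1 : A2) else 0) (i + j)) := by
    ext1 i; ext1 j
    rw [M_symm, sn_sub, sn_nat]
    simp only [Nat.cast_add]
    have : ((i : ℤ) - a + (j - b) = 0) ↔ ((i : ℤ) + j = a + b) := by omega
    simp only [this]
    split_ifs <;> ring
  rw [h, LL_smul, LL_eval_neg (fun n : ℕ => if (n : ℤ) = a + b then (1 : A2) else 0), PP_eval_neg, ← Polynomial.monomial_zero_left, L_monomial]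
  have : (((0 : ℕ) : ℤ) = a + b) ↔ (a + b = 0) := by simp; omega
  simp only [this]
  split_ifs <;> ring

/-- odd weights -/
def o (k : ℕ) : ℂ := if Odd k then k else 0

/-- convolution -/
def cc (n : ℕ) : ℂ := ∑ k ∈ range (n+1), o k * r (n - k)

theorem cc_rec (n : ℕ) : cc (n+1) + cc n = o (n+1) - o n := by
  rw [cc, cc, Finset.sum_range_succ, add_right_comm, ← Finset.sum_add_distrib]
  have : ∀ k ∈ range (n+1), o k * r (n + 1 - k) + o k * r (n - k) = if k = n then - o n else 0 := by
    intro k hk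
    have hk' : k ≤ n := by simp at hk; omega
    rw [← mul_add, show n + 1 - k = (n - k) + 1 by omega, r_rec]
    by_cases h : k = n
    · subst h; simp
    · rw [if_neg (by omega), if_neg h, mul_zero]
  rw [Finset.sum_congr rfl this, Finset.sum_ite_eq']
  simp [r]; ring

theorem cc_closed (n : ℕ) : 4 * cc n = -2 * (-1)^n * (n : ℂ)^2 + 1 - (-1)^n := by
  induction n with
  | zero => simp [cc, o]
  | succ n ih =>
    have h := cc_rec n
    have : cc (n+1) = o (n+1) - o n - cc n := by rw [← h]; ring
    rw [this]
    rcases Nat.even_or_odd n with hn | hn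
    · have h1 : o (n+1) = n + 1 := by rw [o, if_pos hn.add_one]; push_cast; rfl
      have h2 : o n = 0 := by rw [o, if_neg (Nat.not_odd_iff_even.2 hn)]
      rw [hn.neg_one_pow] at ih
      rw [pow_succ, hn.neg_one_pow, h1, h2]; push_cast
      linear_combination -ih
    · have h1 : o (n+1) = 0 := by rw [o, if_neg (Nat.not_odd_iff_even.2 hn.add_one)]
      have h2 : o n = n := by rw [o, if_pos hn]
      rw [hn.neg_one_pow] at ih
      rw [pow_succ, hn.neg_one_pow, h1, h2]; push_cast
      linear_combination -ih

/-- W -/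
def W (i j : ℕ) : A2 := ∑ k ∈ range (j+1), MvPolynomial.C (o k) * M (i + k) (j - k)

theorem W_eq (i j : ℕ) : W i j = ∑ n ∈ range (j+1), MvPolynomial.C (cc n) * (e (i + n) * e (j - n)) := by
  have h1 : W i j = ∑ k ∈ range (j+1), ∑ s ∈ range (j + 1 - k),
      MvPolynomial.C (o k) * (MvPolynomial.C (r s) * (e (i + (k + s : ℕ)) * e (j - (k + s : ℕ)))) := by
    rw [W]
    apply Finset.sum_congr rfl
    intro k hk
    have : ((j : ℤ) - k + 1).toNat = j + 1 - k := by omega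
    rw [M, this, Finset.mul_sum]
    apply Finset.sum_congr rfl
    intro s _
    push_cast
    rw [add_assoc, sub_sub]
  rw [h1, ← Finset.sum_range_diag_flip (j+1) (fun k s =>
      MvPolynomial.C (o k) * (MvPolynomial.C (r s) * (e (i + (k + s : ℕ)) * e (j - (k + s : ℕ)))))]
  apply Finset.sum_congr rfl
  intro n _
  rw [cc, map_sum, Finset.sum_mul]
  apply Finset.sum_congr rfl
  intro k hk
  have : k + (n - k) = n := by simp at hk; omega
  rw [this, map_mul]; ring

theorem C_cc (n : ℕ) : (4 : A2) * MvPolynomial.C (cc n) = -2 * sn n * (n : A2)^2 + 1 - sn n := by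
  have h := congrArg (MvPolynomial.C : ℂ → A2) (cc_closed n)
  rw [sn_nat]
  simp only [map_mul, map_add, map_sub, map_neg, map_pow, map_one, map_natCast, map_ofNat] at h
  linear_combination h

/-- the summand -/
def ph (i j : ℕ) (q : ℤ) : A2 :=
  (-2 * (sn j * sn q) * ((j : A2) - (q : A2))^2 + 1 - sn j * sn q) * (e (i + j - q) * e q)

theorem ph1 (i j : ℕ) : 4 * W i j = ∑ n ∈ range (j+1), ph i j n := by
  rw [← Finset.sum_range_reflect, W_eq, Finset.mul_sum]
  apply Finset.sum_congr rfl
  intro n hn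
  have hn' : ((j + 1 - 1 - n : ℕ) : ℤ) = j - n := by simp at hn; omega
  rw [ph, ← mul_assoc, C_cc, hn', sn_sub, ← mul_assoc (sn j), sn_sq, one_mul]
  rw [show (i : ℤ) + j - (j - n) = i + n by ring]
  have : ((j : A2) - (((j : ℤ) - (n : ℤ) : ℤ) : A2)) = n := by push_cast; ring
  rw [this]

theorem ph2 (i j : ℕ) : 4 * W j i = ∑ x ∈ range i, ph i j ((j + 1 + x : ℕ) : ℤ) := by
  rw [W_eq, Finset.mul_sum, Finset.sum_range_succ']
  have : (4 : A2) * (MvPolynomial.C (cc 0) * (e (j + (0 : ℕ)) * e (i - (0 : ℕ)))) = 0 := by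
    rw [← mul_assoc, C_cc]; simp [sn]
  rw [this, add_zero]
  apply Finset.sum_congr rfl
  intro n hn
  have hh : ((j + 1 + n : ℕ) : ℤ) = j + (n + 1 : ℕ) := by push_cast; ring
  rw [ph, ← mul_assoc, C_cc, hh, sn_add, ← mul_assoc (sn j), sn_sq, one_mul]
  rw [show (i : ℤ) + j - (j + (n + 1 : ℕ)) = i - (n + 1 : ℕ) by ring]
  have : ((j : A2) - (((j : ℤ) + ((n + 1 : ℕ) : ℤ) : ℤ) : A2)) = - ((n + 1 : ℕ) : A2) := by push_cast; ring
  rw [this, neg_sq, mul_comm (e (i - ((n + 1 : ℕ) : ℤ)))]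

theorem ph_key (i j q : ℕ) (hq : q ≤ i + j) : ph i j q =
    (-2 * ((-1)^j * (-1)^q) * ((j : A2) - q)^2 + 1 - (-1)^j * (-1)^q) * (schurOdd dd (i + j - q) * schurOdd dd q) := by
  have : (i : ℤ) + j - q = ((i + j - q : ℕ) : ℤ) := by omega
  rw [ph, this, e_nat, e_nat, sn_nat, sn_nat, Int.cast_natCast]

theorem W_symm (i j : ℕ) : 4 * W i j + 4 * W j i = ∑ q ∈ range (i + j + 1),
    (-2 * ((-1)^j * (-1)^q) * ((j : A2) - q)^2 + 1 - (-1)^j * (-1)^q) * (schurOdd dd (i + j - q) * schurOdd dd q) := by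
  have h3 : ∑ q ∈ range (i + j + 1), ph i j q = ∑ q ∈ range (i + j + 1),
    (-2 * ((-1)^j * (-1)^q) * ((j : A2) - q)^2 + 1 - (-1)^j * (-1)^q) * (schurOdd dd (i + j - q) * schurOdd dd q) :=
    Finset.sum_congr rfl (fun q hq => ph_key i j q (Nat.lt_succ_iff.1 (Finset.mem_range.1 hq)))
  rw [← h3, ph1, ph2 i j, show i + j + 1 = j + 1 + i by ring, Finset.sum_range_add _ (j+1) i]

/-- t1 -/
def t1 (N : ℕ) : A2 := if Odd N then -((N : A2) * dd (N / 2)) else 0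
/-- h -/
def hh (N : ℕ) : A2 := -2 * (∑ q ∈ range (N+1), (-1)^q * (q : A2)^2 * schurOdd dd (N - q) * schurOdd dd q)
  - (if N = 0 then 1 else 0)

theorem W_symm2 (i j : ℕ) : 4 * W i j + 4 * W j i =
    (4 * ((-1)^j * ((j : A2) * t1 (i + j))) + (-1)^j * hh (i + j)) + schurOdd (fun j => 2 * dd j) (i + j) := by
  rw [W_symm, t1, ← T1, ← Tsq, hh, ← T0 dd (i+j)]
  have h0 : (j : A2)^2 * ∑ q ∈ range (i+j+1), (-1)^q * schurOdd dd (i+j - q) * schurOdd dd q = 0 := by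
    rw [T0]; split_ifs with h
    · have : j = 0 := by omega
      simp [this]
    · simp
  have : ∑ q ∈ range (i + j + 1),
    (-2 * ((-1)^j * (-1)^q) * ((j : A2) - q)^2 + 1 - (-1)^j * (-1)^q) * (schurOdd dd (i + j - q) * schurOdd dd q)
    = -2 * (-1)^j * ((j : A2)^2 * ∑ q ∈ range (i+j+1), (-1)^q * schurOdd dd (i+j - q) * schurOdd dd q)
     + (4 * ((-1)^j * ((j : A2) * ∑ q ∈ range (i+j+1), (-1)^q * (q : A2) * schurOdd dd (i+j - q) * schurOdd dd q)) 
     + (-1)^j * (-2 * (∑ q ∈ range (i+j+1), (-1)^q * (q : A2)^2 * schurOdd dd (i+j - q) * schurOdd dd q)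
       - ∑ q ∈ range (i+j+1), (-1)^q * schurOdd dd (i+j - q) * schurOdd dd q))
      + ∑ q ∈ range (i+j+1), schurOdd dd (i+j - q) * schurOdd dd q := by
    simp only [Finset.mul_sum, ← Finset.sum_add_distrib, ← Finset.sum_sub_distrib]
    apply Finset.sum_congr rfl
    intro q _; ring
  rw [this, h0, mul_zero, zero_add]

theorem L_eq_sum (g : ℕ → A2) (p : Polynomial A2) (n : ℕ) (h : p.natDegree < n) :
    L g p = ∑ k ∈ range n, p.coeff k * g k := by
  rw [L, Polynomial.lsum_apply, Polynomial.sum_over_range' _ _ n h] <;> simp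

theorem sum_pairs (f : ℕ → A2) (K : ℕ) :
    ∑ k ∈ range (2 * K), f k = ∑ j ∈ range K, (f (2 * j) + f (2 * j + 1)) := by
  induction K with
  | zero => simp
  | succ K ih => rw [show 2 * (K+1) = 2 * K + 1 + 1 by ring, Finset.sum_range_succ, Finset.sum_range_succ,
      Finset.sum_range_succ _ K, ih, add_assoc]

theorem L_t1 (F : A2) : ∃ K0, ∀ K, K0 ≤ K →
    L t1 (Polynomial.X * (Polynomial.derivative (PP F)).eval (-Polynomial.X)) =
    ∑ j ∈ range K, ((2 * j + 1 : ℕ) : A2) * (dd j * dm j F) := by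
  refine ⟨(Polynomial.X * (Polynomial.derivative (PP F)).eval (-Polynomial.X)).natDegree, ?_⟩
  intro K hK
  rw [L_eq_sum _ _ (2 * K + 1) (by omega), Finset.sum_range_succ']
  simp only [Polynomial.coeff_X_mul]
  rw [sum_pairs]
  have : t1 0 = 0 := by simp [t1]
  rw [this, mul_zero, add_zero]
  apply Finset.sum_congr rfl
  intro j _
  have a1 : ¬ Even (2 * j + 1) := by simp
  have a2 : Even (2 * j) := by simp
  have a3 : Odd (2 * j + 1) := by simp
  have a4 : (2 * j + 1) / 2 = j := by omega
  have a5 : (2 * j) / 2 = j := by omega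
  rw [PP_der, PP_der, if_neg a1, if_pos a2, t1, if_pos a3, a4, a5]
  ring

theorem sumOp_eq (F : A2) : ∃ K0, ∀ K, K0 ≤ K → sumOpOdd F =
    ∑ j ∈ range K, ((2 * j + 1 : ℕ) : A2) * (dd j * dm j F) := by
  refine ⟨F.vars.sup (fun v => v.2 + 1), ?_⟩
  intro K hK
  have hs : F.vars ⊆ (Finset.univ : Finset Bool) ×ˢ range K := by
    intro v hv
    have := Finset.le_sup (f := fun v : Bool × ℕ => v.2 + 1) hv
    simp only [Finset.mem_product, Finset.mem_univ, Finset.mem_range, true_and]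
    omega
  rw [sumOpOdd, Finset.sum_subset hs, Finset.sum_product, Finset.sum_comm]
  · apply Finset.sum_congr rfl
    intro j _
    simp only [Nat.cast_smul_eq_nsmul, nsmul_eq_mul]
    simp [dm, dd]; ring
  · intro v _ hv
    have : MvPolynomial.pderiv v F = 0 := MvPolynomial.pderiv_eq_zero_of_notMem_vars hv
    rw [this]; simp

theorem resNeg_L (k : ℤ) (P : Polynomial A2) :
    resNeg (schurOdd dd) k P = L (fun j => e (j - (k + 1))) P := by
  rw [resNeg, L_eq_sum _ _ _ (Nat.lt_succ_self _)]
  apply Finset.sum_congr rfl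
  intro j _
  rw [mul_comm, e, ← sub_sub]

theorem resNeg_L2 (a : ℕ → A2) (P : Polynomial A2) :
    resNeg (schurOdd a) (-1) P = L (schurOdd a) P := by
  rw [resNeg, L_eq_sum _ _ _ (Nat.lt_succ_self _)]
  apply Finset.sum_congr rfl
  intro j _
  have : (j : ℤ) - -1 - 1 = j := by ring
  rw [mul_comm, this]; simp

theorem main_id (F : A2) (K : ℕ) (hK : (sg 1 F).natDegree < K) :
    8 * ∑ k ∈ range K, MvPolynomial.C (o k) * V (-(k : ℤ)) (V k F) =
    L (schurOdd (fun j => 2 * dd j)) (sg 2 F) - F - 4 * sumOpOdd F := by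
  have hW : ∑ k ∈ range K, MvPolynomial.C (o k) * V (-(k : ℤ)) (V k F) = LL W (PP F) := by
    simp only [VV, ← LL_smul]
    rw [← LL_sum]
    apply LL_congr
    intro i j hj
    have hj' : j < K := lt_of_le_of_lt (hj.trans Polynomial.natDegree_map_le) hK
    rw [W]
    symm
    simp only [sub_neg_eq_add]
    apply Finset.sum_subset
    · intro x hx; simp at *; omega
    · intro x _ hx
      have : ((j : ℤ) - x + 1).toNat = 0 := by simp at hx; omega
      rw [M, this]; simp
  rw [hW]
  have h1 : 8 * LL W (PP F) = LL (fun i j => 4 * W i j + 4 * W j i) (PP F) := by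
    have : LL W (PP F) = LL (fun i j => W j i) (PP F) := by
      conv_lhs => rw [← PP_swap, LL_swap]
    rw [LL_add, LL_smul, LL_smul, ← this]; ring
  rw [h1]
  simp only [W_symm2]
  rw [LL_add, LL_add, LL_smul, LL_eval_der, LL_eval_neg, LL_eval_X, PP_eval_neg, PP_eval_X]
  obtain ⟨K1, h1⟩ := L_t1 F
  obtain ⟨K2, h2⟩ := sumOp_eq F
  rw [h1 (max K1 K2) (le_max_left _ _), ← h2 (max K1 K2) (le_max_right _ _),
    ← Polynomial.monomial_zero_left, L_monomial]
  have : hh 0 = -1 := by simp [hh]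
  rw [this]; ring

theorem idem_aux {E : Type*} [AddCommGroup E] [Module ℂ E] (N : ℕ → E →ₗ[ℂ] E) (S : Finset ℕ) :
    (∀ k ∈ S, ∀ x, N k (N k x) = N k x) →
    (∀ k ∈ S, ∀ l ∈ S, ∀ x, N k (N l x) = N l (N k x)) →
    ∀ d : ℕ, 0 < d → ∀ x, ∑ k ∈ S, (k : ℂ) • N k x + (d : ℂ) • x = 0 → x = 0 := by
  induction S using Finset.induction_on with
  | empty =>
    intro _ _ d hd x hx
    simp only [Finset.sum_empty, zero_add] at hx
    have : (d : ℂ) ≠ 0 := by exact_mod_cast hd.ne'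
    exact (smul_eq_zero.1 hx).resolve_left this
  | insert k S hk ih =>
    intro h1 h2 d hd x hx
    have ih' := ih (fun k hk => h1 k (Finset.mem_insert_of_mem hk))
      (fun k hk l hl => h2 k (Finset.mem_insert_of_mem hk) l (Finset.mem_insert_of_mem hl))
    rw [Finset.sum_insert hk] at hx
    have hN : N k x = 0 := by
      apply ih' (k + d) (by omega)
      have := congrArg (N k) hx
      simp only [map_add, map_smul, map_sum, map_zero, h1 k (Finset.mem_insert_self _ _)] at this
      rw [← this]
      have e1 : ∑ l ∈ S, (l : ℂ) • N l (N k x) = ∑ l ∈ S, (l : ℂ) • N k (N l x) := by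
        apply Finset.sum_congr rfl
        intro l hl
        rw [h2 k (Finset.mem_insert_self _ _) l (Finset.mem_insert_of_mem hl)]
      rw [e1]; push_cast; module
    rw [hN, smul_zero, zero_add] at hx
    exact ih' d hd x hx

theorem idem {E : Type*} [AddCommGroup E] [Module ℂ E] (N : ℕ → E →ₗ[ℂ] E) (S : Finset ℕ)
    (h0 : ∀ k ∈ S, 0 < k)
    (h1 : ∀ k ∈ S, ∀ x, N k (N k x) = N k x)
    (h2 : ∀ k ∈ S, ∀ l ∈ S, ∀ x, N k (N l x) = N l (N k x))
    (x : E) (hx : ∑ k ∈ S, (k : ℂ) • N k x = 0) : ∀ k ∈ S, N k x = 0 := by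
  intro k hk
  apply idem_aux N (S.erase k) (fun k hk => h1 k (Finset.mem_of_mem_erase hk))
    (fun k hk l hl => h2 k (Finset.mem_of_mem_erase hk) l (Finset.mem_of_mem_erase hl)) k (h0 k hk)
  have := congrArg (N k) hx
  rw [map_zero, map_sum, ← Finset.sum_erase_add _ _ hk, map_smul, h1 k hk] at this
  rw [← this]
  congr 1
  apply Finset.sum_congr rfl
  intro l hl
  rw [map_smul, h2 k hk l (Finset.mem_of_mem_erase hl)]

theorem V_anti0 (a b : ℤ) (h : a + b ≠ 0) (F : A2) : V a (V b F) = - V b (V a F) := by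
  have := V_anti a b F
  rw [if_neg h] at this
  exact eq_neg_of_add_eq_zero_left this

theorem V_sq (a : ℤ) (h : a ≠ 0) (F : A2) : V a (V a F) = 0 := by
  have := V_anti a a F
  rw [if_neg (by omega), ← two_mul] at this
  simpa using this

theorem V_three (k : ℕ) (hk : Odd k) (F : A2) : V k (V (-(k : ℤ)) (V k F)) = (-2 : ℂ) • V k F := by
  have h0 : k ≠ 0 := by rintro rfl; simp at hk
  have := V_anti k (-(k : ℤ)) (V k F)
  rw [if_pos (by omega), V_sq k (by omega), map_zero, add_zero] at this
  rw [this]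
  have : sn (-(k : ℤ)) = -1 := by
    rw [sn, if_neg]; simp [hk]
  rw [this, MvPolynomial.smul_eq_C_mul, map_neg, map_ofNat]; ring

/-- idempotents -/
def Nk (k : ℕ) : A2 →ₗ[ℂ] A2 := (-1/2 : ℂ) • (V (-(k : ℤ))).comp (V k)

theorem Nk_apply (k : ℕ) (F : A2) : Nk k F = (-1/2 : ℂ) • V (-(k : ℤ)) (V k F) := rfl

theorem Nk_idem (k : ℕ) (hk : Odd k) (F : A2) : Nk k (Nk k F) = Nk k F := by
  simp only [Nk_apply, map_smul, V_three k hk, smul_smul]; norm_num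

theorem comm4 {E : Type*} [AddCommGroup E] [Module ℂ E] (A B C D : E →ₗ[ℂ] E)
    (h1 : ∀ x, A (C x) = - C (A x)) (h2 : ∀ x, A (D x) = - D (A x))
    (h3 : ∀ x, B (C x) = - C (B x)) (h4 : ∀ x, B (D x) = - D (B x)) (F : E) :
    A (B (C (D F))) = C (D (A (B F))) := by
  rw [h3, h4]; simp only [map_neg, neg_neg]; rw [h1, h2]; simp only [map_neg, neg_neg]

theorem Nk_comm (k l : ℕ) (hk : Odd k) (hl : Odd l) (F : A2) : Nk k (Nk l F) = Nk l (Nk k F) := by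
  have h0 := hk.pos
  have h1 := hl.pos
  by_cases h : k = l
  · subst h; rfl
  simp only [Nk_apply, map_smul]
  rw [comm4 (V (-(k : ℤ))) (V k) (V (-(l : ℤ))) (V l) (V_anti0 _ _ (by omega)) (V_anti0 _ _ (by omega))
    (V_anti0 _ _ (by omega)) (V_anti0 _ _ (by omega)) F]

theorem main_iff (F : A2) :
    (L (schurOdd (fun j => 2 * dd j)) (sg 2 F) = (4 : ℂ) • sumOpOdd F + F) ↔
      ∀ m : ℕ, V (2 * (m : ℤ) + 1) F = 0 := by
  set K := (sg 1 F).natDegree + 1 with hK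
  have hm := main_id F K (by omega)
  have h4 : (4 : ℂ) • sumOpOdd F = 4 * sumOpOdd F := by
    rw [MvPolynomial.smul_eq_C_mul, map_ofNat]
  rw [h4]
  constructor
  · intro h
    have hz : ∑ k ∈ range K, MvPolynomial.C (o k) * V (-(k : ℤ)) (V k F) = 0 := by
      rw [h] at hm
      have : (8 : A2) * ∑ k ∈ range K, MvPolynomial.C (o k) * V (-(k : ℤ)) (V k F) = 0 := by
        rw [hm]; ring
      simpa using this
    have hN : ∑ k ∈ (range K).filter Odd, (k : ℂ) • Nk k F = 0 := by
      rw [Finset.sum_filter]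
      have : ∀ k ∈ range K, (if Odd k then (k : ℂ) • Nk k F else 0) =
          (-1/2 : ℂ) • (MvPolynomial.C (o k) * V (-(k : ℤ)) (V k F)) := by
        intro k _
        rw [o]
        split_ifs with ho
        · rw [Nk_apply, ← MvPolynomial.smul_eq_C_mul, smul_comm]
        · simp
      rw [Finset.sum_congr rfl this, ← Finset.smul_sum, hz, smul_zero]
    have hall := idem Nk _ (fun k hk => ((Finset.mem_filter.1 hk).2).pos)
      (fun k hk => Nk_idem k (Finset.mem_filter.1 hk).2)
      (fun k hk l hl => Nk_comm k l (Finset.mem_filter.1 hk).2 (Finset.mem_filter.1 hl).2) F hN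
    intro m
    have hcast : (2 * (m : ℤ) + 1) = ((2 * m + 1 : ℕ) : ℤ) := by push_cast; rfl
    rw [hcast]
    have ho : Odd (2 * m + 1) := ⟨m, rfl⟩
    rcases lt_or_ge (2 * m + 1) K with hlt | hge
    · have h1 := hall (2 * m + 1) (by simp [hlt])
      have h2 := congrArg (V ((2 * m + 1 : ℕ) : ℤ)) h1
      rw [Nk_apply, map_smul, V_three _ ho, map_zero, smul_smul] at h2
      norm_num at h2
      exact_mod_cast h2
    · rw [V_apply, L_eq_sum _ _ K (by omega)]
      apply Finset.sum_eq_zero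
      intro j hj
      rw [e_neg, mul_zero]
      simp at hj; omega
  · intro h
    have hz : ∑ k ∈ range K, MvPolynomial.C (o k) * V (-(k : ℤ)) (V k F) = 0 := by
      apply Finset.sum_eq_zero
      intro k _
      rw [o]
      split_ifs with ho
      · obtain ⟨m, rfl⟩ := ho
        have := h m
        push_cast
        rw [this]; simp
      · simp
    rw [hz] at hm
    linear_combination -hm

theorem subst_eq (b : Bool) (c : ℂ) (τ : MvPolynomial ℕ ℂ) :
    substShiftOdd b (eps b * c) τ = sg c (MvPolynomial.rename (fun j => (b, j)) τ) := by
  rw [sg, MvPolynomial.aeval_rename]; rfl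

end KW

/-- Equivalence of the Kac–Wakimoto and DJKM forms of the twisted
`ŝl₂` (KdV) hierarchy, for a polynomial `τ ∈ ℂ[t₁,t₃,t₅,…]`. -/
theorem stmt13 (τ : MvPolynomial ℕ ℂ) :
    (resNeg (schurOdd fun j => 2 * (MvPolynomial.X ((false, j) : Bool × ℕ) -
          MvPolynomial.X ((true, j) : Bool × ℕ))) (-1)
        (substShiftOdd false (-2) τ * substShiftOdd true 2 τ)
      = (4 : ℂ) • sumOpOdd (MvPolynomial.rename (fun j => ((false, j) : Bool × ℕ)) τ *
            MvPolynomial.rename (fun j => ((true, j) : Bool × ℕ)) τ)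
        + MvPolynomial.rename (fun j => ((false, j) : Bool × ℕ)) τ *
            MvPolynomial.rename (fun j => ((true, j) : Bool × ℕ)) τ)
    ↔
    (∀ m : ℕ,
      resNeg (schurOdd fun j => MvPolynomial.X ((false, j) : Bool × ℕ) -
          MvPolynomial.X ((true, j) : Bool × ℕ)) (2 * (m : ℤ))
        (substShiftOdd false (-1) τ * substShiftOdd true 1 τ) = 0) := by
  have s1 : ∀ c : ℂ, substShiftOdd false (-c) τ * substShiftOdd true c τ =
      KW.sg c (MvPolynomial.rename (fun j => ((false, j) : Bool × ℕ)) τ *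
            MvPolynomial.rename (fun j => ((true, j) : Bool × ℕ)) τ) := by
    intro c
    rw [map_mul, ← KW.subst_eq, ← KW.subst_eq]
    simp [KW.eps]
  rw [s1, s1]
  have h := KW.main_iff (MvPolynomial.rename (fun j => ((false, j) : Bool × ℕ)) τ *
            MvPolynomial.rename (fun j => ((true, j) : Bool × ℕ)) τ)
  simp only [KW.V_apply, ← KW.resNeg_L] at h
  rw [← KW.resNeg_L2] at h
  exact h

end
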